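/- Let A be a closed, monotone, quasidense subset of E × E*, let (w, w*) ∈ E × E* and let α, β > 0. Then there exists exactly one τ ≥ 0 such that (ατ, βτ) is a negative alignment pair for A with respect to (w, w*). -/

import Mathlib

noncomputable section

open Filter Topology

variable {E : Type*} [NormedAddCommGroup E] [NormedSpace ℝ E]

/-- `A ⊆ E × E*` is a monotone set. -/
def MonotoneSet (A : Set (E × (E →L[ℝ] ℝ))) : Prop :=
  A.Nonempty ∧ ∀ p ∈ A, ∀ q ∈ A, 0 ≤ (p.2 - q.2) (p.1 - q.1)

/-- `A ⊆ E × E*` is maximally monotone. -/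
def MaxMonotone (A : Set (E × (E →L[ℝ] ℝ))) : Prop :=
  MonotoneSet A ∧ ∀ A' : Set (E × (E →L[ℝ] ℝ)), MonotoneSet A' → A ⊆ A' → A' = A

/-- `r_L((s,s*) - (x,x*)) = (1/2)‖s - x‖² + (1/2)‖s* - x*‖² + ⟨s - x, s* - x*⟩`. -/
def rQ (q p : E × (E →L[ℝ] ℝ)) : ℝ :=
  (1 / 2) * ‖q.1 - p.1‖ ^ 2 + (1 / 2) * ‖q.2 - p.2‖ ^ 2 + (q.2 - p.2) (q.1 - p.1)

/-- `A ⊆ E × E*` is quasidense. -/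
def Quasidense (A : Set (E × (E →L[ℝ] ℝ))) : Prop :=
  ∀ p : E × (E →L[ℝ] ℝ), (⨅ q ∈ A, ((rQ q p : ℝ) : EReal)) ≤ 0

/-- `A ⊆ E × E*` is stably quasidense (with the norm
`‖(x, x*)‖ = (‖x‖² + ‖x*‖²)^{1/2}` on `E × E*`). -/
def StablyQuasidense (A : Set (E × (E →L[ℝ] ℝ))) : Prop :=
  ∀ p : E × (E →L[ℝ] ℝ), ∃ K : ℝ, 0 ≤ K ∧
    (⨅ q ∈ {q ∈ A | Real.sqrt (‖q.1 - p.1‖ ^ 2 + ‖q.2 - p.2‖ ^ 2) ≤ K},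
      ((rQ q p : ℝ) : EReal)) ≤ 0

/-- `(ρ, σ)` is a negative alignment pair for `A` with respect to `w = (w, w*)`. -/
def NegAlignPair (A : Set (E × (E →L[ℝ] ℝ))) (w : E × (E →L[ℝ] ℝ)) (ρ σ : ℝ) : Prop :=
  ∃ s : ℕ → E × (E →L[ℝ] ℝ), (∀ n, s n ∈ A) ∧
    Tendsto (fun n => ‖(s n).1 - w.1‖) atTop (𝓝 ρ) ∧
    Tendsto (fun n => ‖(s n).2 - w.2‖) atTop (𝓝 σ) ∧
    Tendsto (fun n => ((s n).2 - w.2) ((s n).1 - w.1)) atTop (𝓝 (-(ρ * σ)))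

theorem Quasidense.exists_rQ_lt {A : Set (E × (E →L[ℝ] ℝ))} (h : Quasidense A)
    (p : E × (E →L[ℝ] ℝ)) {ε : ℝ} (hε : 0 < ε) : ∃ q ∈ A, rQ q p < ε := by
  have h1 : (⨅ q ∈ A, ((rQ q p : ℝ) : EReal)) < (ε : EReal) :=
    lt_of_le_of_lt (h p) (by exact_mod_cast hε)
  simp only [iInf_lt_iff] at h1
  obtain ⟨q, hq, hlt⟩ := h1
  exact ⟨q, hq, by exact_mod_cast hlt⟩

/-- A continuous functional nearly attains `-r‖f‖` on the ball of radius `r`. -/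
theorem exists_norm_le_apply_le {F : Type*} [NormedAddCommGroup F] [NormedSpace ℝ F]
    (f : F →L[ℝ] ℝ) {r ε : ℝ} (hr : 0 ≤ r) (hε : 0 < ε) :
    ∃ x : F, ‖x‖ ≤ r ∧ f x ≤ -(r * ‖f‖) + ε := by
  obtain ⟨v, hv, hfv⟩ := f.exists_lt_apply_of_lt_opNorm
    (sub_lt_self ‖f‖ (div_pos hε (by linarith : 0 < r + 1)))
  have hr1 : r * (ε / (r + 1)) ≤ ε := by
    rw [mul_div_assoc', div_le_iff₀ (by linarith)]
    nlinarith
  have h1 := mul_le_mul_of_nonneg_left hfv.le hr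
  rw [Real.norm_eq_abs] at h1
  have hrv : r * ‖v‖ ≤ r := mul_le_of_le_one_right hr hv.le
  rcases abs_cases (f v) with ⟨h, _⟩ | ⟨h, _⟩ <;> rw [h] at h1
  · refine ⟨-(r • v), by rwa [norm_neg, norm_smul, Real.norm_of_nonneg hr], ?_⟩
    rw [map_neg, map_smul, smul_eq_mul]
    linarith
  · refine ⟨r • v, by rwa [norm_smul, Real.norm_of_nonneg hr], ?_⟩
    rw [map_smul, smul_eq_mul]
    linarith

/-- A quasidense set is of negative infimum type. -/
theorem Quasidense.exists_negative_infimum {A : Set (E × (E →L[ℝ] ℝ))} (h : Quasidense A)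
    (y : E →L[ℝ] ℝ) (Y : (E →L[ℝ] ℝ) →L[ℝ] ℝ) {ε : ℝ} (hε : 0 < ε) :
    ∃ q ∈ A, Y y - ε ≤ y q.1 + Y q.2 - q.2 q.1 := by
  obtain ⟨z, hz, hYz⟩ := exists_norm_le_apply_le Y (norm_nonneg Y) (half_pos hε)
  obtain ⟨q, hq, hr⟩ := h.exists_rQ_lt (0, y - z) (half_pos hε)
  refine ⟨q, hq, ?_⟩
  simp only [rQ, sub_zero] at hr
  set d := q.2 - (y - z) with hd
  have hq2 : q.2 = d + y - z := by rw [hd]; abel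
  have h1 : -(‖Y‖ * ‖q.1‖) ≤ z q.1 := by
    have := neg_le_of_abs_le (z.le_opNorm q.1)
    have := mul_le_mul_of_nonneg_right hz (norm_nonneg q.1)
    linarith
  have h2 : -(‖Y‖ * ‖d‖) ≤ Y d := neg_le_of_abs_le (Y.le_opNorm d)
  rw [hq2]
  simp only [map_add, map_sub, add_apply, sub_apply]
  nlinarith [sq_nonneg (‖q.1‖ - ‖Y‖), sq_nonneg (‖d‖ - ‖Y‖)]

/-- Fenchel duality for the Fitzpatrick function of `A` and a weighted square of the norm. -/
theorem exists_fitzpatrick_add_sq_lt {A : Set (E × (E →L[ℝ] ℝ))} (hA : MonotoneSet A)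
    (h : Quasidense A) {l m δ : ℝ} (hl : 0 < l) (hm : 0 < m) (hlm : l * m = 1) (hδ : 0 < δ) :
    ∃ (x : E) (x' : E →L[ℝ] ℝ) (t : ℝ), (∀ q ∈ A, x' q.1 + q.2 x - q.2 q.1 ≤ t) ∧
      t + (l / 2 * ‖x‖ ^ 2 + m / 2 * ‖x'‖ ^ 2) < δ := by
  by_contra! hcon
  let C : Set (E × (E →L[ℝ] ℝ) × ℝ) := {z | ∀ q ∈ A, z.2.1 q.1 + q.2 z.1 - q.2 q.1 ≤ z.2.2}
  let D : Set (E × (E →L[ℝ] ℝ) × ℝ) :=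
    {z | z.2.2 + (l / 2 * ‖z.1‖ ^ 2 + m / 2 * ‖z.2.1‖ ^ 2) < δ}
  have hC : Convex ℝ C := by
    intro z hz w hw a b ha hb hab q hq
    have h1 := mul_le_mul_of_nonneg_left (hz q hq) ha
    have h2 := mul_le_mul_of_nonneg_left (hw q hq) hb
    have h3 : q.2 q.1 = a * q.2 q.1 + b * q.2 q.1 := by rw [← add_mul, hab, one_mul]
    simp only [Prod.fst_add, Prod.snd_add, Prod.smul_fst, Prod.smul_snd, map_add, map_smul,
      add_apply, smul_apply, smul_eq_mul]
    linarith
  have hDo : IsOpen D := isOpen_lt (by fun_prop) continuous_const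
  have hsq : ∀ {F : Type _} [NormedAddCommGroup F] [NormedSpace ℝ F],
      ConvexOn ℝ Set.univ fun x : F => ‖x‖ ^ 2 := fun {F} _ _ =>
    (convexOn_norm convex_univ).pow (fun _ _ => norm_nonneg _) 2
  have hDc : Convex ℝ D := by
    intro z hz w hw a b ha hb hab
    have h1 := mul_le_mul_of_nonneg_left
      ((hsq (F := E)).2 (Set.mem_univ z.1) (Set.mem_univ w.1) ha hb hab) hl.le
    have h2 := mul_le_mul_of_nonneg_left
      ((hsq (F := E →L[ℝ] ℝ)).2 (Set.mem_univ z.2.1) (Set.mem_univ w.2.1) ha hb hab) hm.le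
    simp only [smul_eq_mul] at h1 h2
    simp only [D, Set.mem_ofPred_eq] at hz hw
    have h3 : a * (z.2.2 + (l / 2 * ‖z.1‖ ^ 2 + m / 2 * ‖z.2.1‖ ^ 2)) +
        b * (w.2.2 + (l / 2 * ‖w.1‖ ^ 2 + m / 2 * ‖w.2.1‖ ^ 2)) < δ := by
      rcases ha.eq_or_lt with rfl | ha
      · obtain rfl : b = 1 := by linarith
        linarith
      · have := mul_lt_mul_of_pos_left hz ha
        have := mul_le_mul_of_nonneg_left hw.le hb
        have : a * δ + b * δ = δ := by rw [← add_mul, hab, one_mul]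
        linarith
    simp only [D, Set.mem_ofPred_eq, Prod.fst_add, Prod.snd_add, Prod.smul_fst, Prod.smul_snd,
      smul_eq_mul]
    linarith
  have hdisj : Disjoint D C := Set.disjoint_left.2 fun z hz hz' =>
    absurd (hcon z.1 z.2.1 z.2.2 hz') (not_le.2 hz)
  obtain ⟨f, u, hfD, hfC⟩ := geometric_hahn_banach_open hDc hDo hC hdisj
  set c := f (0, 0, 1) with hc
  have hf : ∀ x x' t, f (x, x', t) = f (x, 0, 0) + f (0, x', 0) + t * c := by
    intro x x' t
    rw [hc, ← smul_eq_mul, ← map_smul, ← map_add, ← map_add]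
    simp
  have hAC : ∀ a ∈ A, (a.1, a.2, a.2 a.1) ∈ C := by
    intro a ha q hq
    have := hA.2 a ha q hq
    simp only [sub_apply, map_sub] at this
    simp only
    linarith
  have hcpos : 0 < c := by
    obtain ⟨a, ha⟩ := hA.1
    have h1 := hfC _ (hAC a ha)
    have h2 := hcon a.1 a.2 _ (hAC a ha)
    have h3 := hfD (a.1, a.2, δ - (l / 2 * ‖a.1‖ ^ 2 + m / 2 * ‖a.2‖ ^ 2) - 1)
      (by simp only [D, Set.mem_ofPred_eq]; linarith)
    rw [hf] at h1 h3
    by_contra! hc0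
    nlinarith
  let y : E →L[ℝ] ℝ := -(c⁻¹ • f.comp (ContinuousLinearMap.inl ℝ E ((E →L[ℝ] ℝ) × ℝ)))
  let Y : (E →L[ℝ] ℝ) →L[ℝ] ℝ := -(c⁻¹ • f.comp
    ((ContinuousLinearMap.inr ℝ E ((E →L[ℝ] ℝ) × ℝ)).comp
      (ContinuousLinearMap.inl ℝ (E →L[ℝ] ℝ) ℝ)))
  have hy : ∀ x, f (x, 0, 0) = -c * y x := by
    intro x
    simp [y, hcpos.ne', ← Prod.zero_eq_mk]
  have hY : ∀ x', f (0, x', 0) = -c * Y x' := by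
    intro x'
    simp [Y, hcpos.ne']
  have hδ6 : 0 < δ / 6 := by positivity
  obtain ⟨a, ha, hNI⟩ := h.exists_negative_infimum y Y hδ6
  obtain ⟨x, hx, hyx⟩ := exists_norm_le_apply_le y (mul_nonneg hm.le (norm_nonneg y)) hδ6
  obtain ⟨x', hx', hYx⟩ := exists_norm_le_apply_le Y (mul_nonneg hl.le (norm_nonneg Y)) hδ6
  have h1 := hfC _ (hAC a ha)
  have h2 := hfD (x, x', δ / 2 - (l / 2 * ‖x‖ ^ 2 + m / 2 * ‖x'‖ ^ 2))
      (by simp only [D, Set.mem_ofPred_eq]; linarith)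
  rw [hf, hy, hY] at h1 h2
  have h3 := h2.trans_le h1
  have h4 : -y x - Y x' + (δ / 2 - (l / 2 * ‖x‖ ^ 2 + m / 2 * ‖x'‖ ^ 2)) <
      -y a.1 - Y a.2 + a.2 a.1 := by
    refine lt_of_mul_lt_mul_left ?_ hcpos.le
    linarith
  have h5 : l * ‖x‖ ^ 2 ≤ m * ‖y‖ ^ 2 := by
    calc l * ‖x‖ ^ 2 ≤ l * (m * ‖y‖) ^ 2 := by gcongr
      _ = (l * m) * m * ‖y‖ ^ 2 := by ring
      _ = m * ‖y‖ ^ 2 := by rw [hlm, one_mul]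
  have h6 : m * ‖x'‖ ^ 2 ≤ l * ‖Y‖ ^ 2 := by
    calc m * ‖x'‖ ^ 2 ≤ m * (l * ‖Y‖) ^ 2 := by gcongr
      _ = (l * m) * l * ‖Y‖ ^ 2 := by ring
      _ = l * ‖Y‖ ^ 2 := by rw [hlm, one_mul]
  have h7 : -(‖Y‖ * ‖y‖) ≤ Y y := neg_le_of_abs_le (Y.le_opNorm y)
  have h8 : ‖Y‖ * ‖y‖ ≤ m / 2 * ‖y‖ ^ 2 + l / 2 * ‖Y‖ ^ 2 := by
    have h9 : 0 ≤ m / 2 * (‖y‖ - l * ‖Y‖) ^ 2 := by positivity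
    have h10 : m / 2 * (‖y‖ - l * ‖Y‖) ^ 2 =
        m / 2 * ‖y‖ ^ 2 + (l * m) * (l / 2 * ‖Y‖ ^ 2) - (l * m) * (‖Y‖ * ‖y‖) := by ring
    rw [hlm] at h10
    linarith
  linarith

/-- Points where the Fitzpatrick function is close to the duality pairing are close to `A`. -/
theorem Quasidense.exists_near {A : Set (E × (E →L[ℝ] ℝ))} (h : Quasidense A)
    {x : E} {x' : E →L[ℝ] ℝ} {t ε : ℝ} (hε : 0 < ε)
    (hx : ∀ q ∈ A, x' q.1 + q.2 x - q.2 q.1 ≤ t) :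
    ∃ q ∈ A, ‖q.1 - x‖ ^ 2 + ‖q.2 - x'‖ ^ 2 ≤ 2 * (t - x' x + ε) := by
  obtain ⟨q, hq, hr⟩ := h.exists_rQ_lt (x, x') hε
  refine ⟨q, hq, ?_⟩
  have := hx q hq
  simp only [rQ, sub_apply, map_sub] at hr
  linarith

theorem half_mul_sq_le_weighted {l m : ℝ} (hlm : l * m = 1) (x : E) (x' : E →L[ℝ] ℝ) :
    m / 2 * (l * ‖x‖ - ‖x'‖) ^ 2 ≤ l / 2 * ‖x‖ ^ 2 + m / 2 * ‖x'‖ ^ 2 + x' x := by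
  have h1 : -(‖x'‖ * ‖x‖) ≤ x' x := neg_le_of_abs_le (x'.le_opNorm x)
  have h2 : m / 2 * (l * ‖x‖ - ‖x'‖) ^ 2 =
      (l * m) * (l / 2 * ‖x‖ ^ 2) + m / 2 * ‖x'‖ ^ 2 - (l * m) * (‖x'‖ * ‖x‖) := by ring
  rw [h2, hlm]
  linarith

/-- Weighted Young inequality. -/
theorem mul_le_quarter_mul_sq_add {l m : ℝ} (hl : 0 < l) (hlm : l * m = 1) (a b : ℝ) :
    a * b ≤ l / 4 * b ^ 2 + m * a ^ 2 := by
  have h1 : 0 ≤ l * (b / 2 - m * a) ^ 2 := by positivity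
  have h2 : l * (b / 2 - m * a) ^ 2 =
      l / 4 * b ^ 2 - (l * m) * (a * b) + (l * m) * (m * a ^ 2) := by ring
  rw [h2, hlm] at h1
  linarith

theorem le_of_quarter_mul_sq_le {l m b M : ℝ} (hm : 0 < m) (hlm : l * m = 1)
    (h : l / 4 * b ^ 2 ≤ M) : b ≤ 4 * m * M + 1 := by
  have h1 := mul_le_mul_of_nonneg_left h (by positivity : 0 ≤ 4 * m)
  have h2 : 4 * m * (l / 4 * b ^ 2) = (l * m) * b ^ 2 := by ring
  rw [h2, hlm] at h1
  nlinarith [sq_nonneg (b - 1)]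

/-- Approximate minimizers of the weighted functional near `A`, in a fixed bounded set. -/
theorem Quasidense.exists_bounded_approx {A : Set (E × (E →L[ℝ] ℝ))} (hA : MonotoneSet A)
    (h : Quasidense A) {l m : ℝ} (hl : 0 < l) (hm : 0 < m) (hlm : l * m = 1) :
    ∃ R : ℝ, ∀ δ : ℝ, 0 < δ → δ ≤ 1 → ∃ q ∈ A, ∃ (x : E) (x' : E →L[ℝ] ℝ),
      ‖x‖ ≤ R ∧ ‖x'‖ ≤ R ∧ l / 2 * ‖x‖ ^ 2 + m / 2 * ‖x'‖ ^ 2 + x' x ≤ δ ∧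
      ‖q.1 - x‖ ≤ 2 * √δ ∧ ‖q.2 - x'‖ ≤ 2 * √δ := by
  obtain ⟨a, ha⟩ := hA.1
  let M := 1 + |a.2 a.1| + m * ‖a.2‖ ^ 2 + l * ‖a.1‖ ^ 2
  refine ⟨max (4 * m * M + 1) (4 * l * M + 1), fun δ hδ hδ1 => ?_⟩
  obtain ⟨x, x', t, ht, hlt⟩ := exists_fitzpatrick_add_sq_lt hA h hl hm hlm hδ
  have hpair : x' x ≤ t := le_of_forall_pos_le_add fun ε hε => by
    obtain ⟨q, -, hq⟩ := h.exists_near hε ht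
    nlinarith [sq_nonneg ‖q.1 - x‖, sq_nonneg ‖q.2 - x'‖]
  obtain ⟨q, hq, hnear⟩ := h.exists_near hδ ht
  have hg := half_mul_sq_le_weighted hlm x x'
  have hg0 : 0 ≤ m / 2 * (l * ‖x‖ - ‖x'‖) ^ 2 := by positivity
  have hsq : √δ ^ 2 = δ := Real.sq_sqrt hδ.le
  have hM : l / 4 * ‖x‖ ^ 2 + m / 4 * ‖x'‖ ^ 2 ≤ M := by
    have h1 := ht a ha
    have h2 : -(‖x'‖ * ‖a.1‖) ≤ x' a.1 := neg_le_of_abs_le (x'.le_opNorm a.1)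
    have h3 : -(‖a.2‖ * ‖x‖) ≤ a.2 x := neg_le_of_abs_le (a.2.le_opNorm x)
    have h4 := mul_le_quarter_mul_sq_add hl hlm ‖a.2‖ ‖x‖
    have h5 := mul_le_quarter_mul_sq_add hm (by linarith : m * l = 1) ‖a.1‖ ‖x'‖
    have h6 := le_abs_self (a.2 a.1)
    simp only [M]
    linarith
  have hx0 : 0 ≤ l / 4 * ‖x‖ ^ 2 := by positivity
  have hx0' : 0 ≤ m / 4 * ‖x'‖ ^ 2 := by positivity
  refine ⟨q, hq, x, x', ?_, ?_, by linarith, ?_, ?_⟩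
  · exact (le_of_quarter_mul_sq_le hm hlm (by linarith)).trans (le_max_left _ _)
  · exact (le_of_quarter_mul_sq_le hl (by linarith : m * l = 1) (by linarith)).trans
      (le_max_right _ _)
  · refine le_of_sq_le_sq ?_ (by positivity)
    rw [mul_pow, hsq]
    nlinarith [sq_nonneg ‖q.2 - x'‖]
  · refine le_of_sq_le_sq ?_ (by positivity)
    rw [mul_pow, hsq]
    nlinarith [sq_nonneg ‖q.1 - x‖]

theorem Quasidense.exists_negAlignPair_zero {A : Set (E × (E →L[ℝ] ℝ))} (hA : MonotoneSet A)
    (h : Quasidense A) {l m : ℝ} (hl : 0 < l) (hm : 0 < m) (hlm : l * m = 1) :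
    ∃ ρ : ℝ, 0 ≤ ρ ∧ NegAlignPair A 0 ρ (l * ρ) := by
  obtain ⟨R, hR⟩ := h.exists_bounded_approx hA hl hm hlm
  have hδ : ∀ n : ℕ, (0 : ℝ) < 1 / (n + 1) ∧ (1 : ℝ) / (n + 1) ≤ 1 := fun n =>
    ⟨Nat.one_div_pos_of_nat, by rw [div_le_one (by positivity)]; linarith [n.cast_nonneg (α := ℝ)]⟩
  choose q hq x x' hx hx' hg hqx hqx' using fun n : ℕ => hR _ (hδ n).1 (hδ n).2
  obtain ⟨⟨ρ, σ⟩, -, φ, hφ, hlim⟩ := (isCompact_Icc (a := ((0 : ℝ), (0 : ℝ)))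
    (b := (R, R))).tendsto_subseq (x := fun n => (‖x n‖, ‖x' n‖))
    fun n => ⟨⟨norm_nonneg _, norm_nonneg _⟩, ⟨hx n, hx' n⟩⟩
  have hX : Tendsto (fun n => ‖x (φ n)‖) atTop (𝓝 ρ) := (Prod.tendsto_iff _ _).1 hlim |>.1
  have hX' : Tendsto (fun n => ‖x' (φ n)‖) atTop (𝓝 σ) := (Prod.tendsto_iff _ _).1 hlim |>.2
  have hδ0 : Tendsto (fun n => (1 : ℝ) / (φ n + 1)) atTop (𝓝 0) :=
    tendsto_one_div_add_atTop_nhds_zero_nat.comp hφ.tendsto_atTop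
  have hsqrt : Tendsto (fun n => 2 * √((1 : ℝ) / (φ n + 1))) atTop (𝓝 0) := by
    simpa using (hδ0.sqrt).const_mul 2
  have hσ : σ = l * ρ := by
    have h1 : m / 2 * (l * ρ - σ) ^ 2 ≤ 0 :=
      le_of_tendsto_of_tendsto' ((((hX.const_mul l).sub hX').pow 2).const_mul (m / 2)) hδ0
        fun n => (half_mul_sq_le_weighted hlm _ _).trans (hg (φ n))
    have h2 : (l * ρ - σ) ^ 2 = 0 := le_antisymm
      (nonpos_of_mul_nonpos_right h1 (by positivity)) (sq_nonneg _)
    linarith [pow_eq_zero_iff (two_ne_zero) |>.1 h2]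
  have hG : Tendsto (fun n => l / 2 * ‖x (φ n)‖ ^ 2 + m / 2 * ‖x' (φ n)‖ ^ 2) atTop
      (𝓝 (ρ * (l * ρ))) := by
    have h1 := ((hX.pow 2).const_mul (l / 2)).add ((hX'.pow 2).const_mul (m / 2))
    have h2 : l / 2 * ρ ^ 2 + m / 2 * σ ^ 2 = ρ * (l * ρ) := by
      have h3 : m / 2 * (l * ρ) ^ 2 = (l * m) * (l / 2 * ρ ^ 2) := by ring
      rw [hσ, h3, hlm]
      ring
    rwa [h2] at h1
  have hP : Tendsto (fun n => x' (φ n) (x (φ n))) atTop (𝓝 (-(ρ * (l * ρ)))) := by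
    refine tendsto_of_tendsto_of_tendsto_of_le_of_le hG.neg (h := fun n => 1 / ((φ n : ℝ) + 1) -
      (l / 2 * ‖x (φ n)‖ ^ 2 + m / 2 * ‖x' (φ n)‖ ^ 2)) (by simpa using hδ0.sub hG)
      (fun n => ?_) (fun n => ?_)
    · have h1 := half_mul_sq_le_weighted hlm (x (φ n)) (x' (φ n))
      have h2 : 0 ≤ m / 2 * (l * ‖x (φ n)‖ - ‖x' (φ n)‖) ^ 2 := by positivity
      simp only
      linarith
    · have := hg (φ n)
      simp only
      linarith
  have hd : Tendsto (fun n => ‖(q (φ n)).1 - x (φ n)‖) atTop (𝓝 0) :=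
    squeeze_zero (fun _ => norm_nonneg _) (fun n => hqx (φ n)) hsqrt
  have hd' : Tendsto (fun n => ‖(q (φ n)).2 - x' (φ n)‖) atTop (𝓝 0) :=
    squeeze_zero (fun _ => norm_nonneg _) (fun n => hqx' (φ n)) hsqrt
  have hQ : Tendsto (fun n => ‖(q (φ n)).1‖) atTop (𝓝 ρ) := by
    have h1 := squeeze_zero_norm
      (f := fun n => ‖(q (φ n)).1‖ - ‖x (φ n)‖) (fun n => abs_norm_sub_norm_le _ _) hd
    simpa using h1.add hX
  have hQ' : Tendsto (fun n => ‖(q (φ n)).2‖) atTop (𝓝 σ) := by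
    have h1 := squeeze_zero_norm
      (f := fun n => ‖(q (φ n)).2‖ - ‖x' (φ n)‖) (fun n => abs_norm_sub_norm_le _ _) hd'
    simpa using h1.add hX'
  refine ⟨ρ, ge_of_tendsto' hX fun _ => norm_nonneg _, fun n => q (φ n), fun n => hq _, ?_, ?_, ?_⟩
  · simpa using hQ
  · simpa [← hσ] using hQ'
  · have h1 : Tendsto (fun n => (q (φ n)).2 (q (φ n)).1 - x' (φ n) (x (φ n))) atTop (𝓝 0) := by
      refine squeeze_zero_norm (a := fun n => ‖(q (φ n)).2‖ * ‖(q (φ n)).1 - x (φ n)‖ +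
        ‖(q (φ n)).2 - x' (φ n)‖ * ‖x (φ n)‖) (fun n => ?_)
        (by simpa using (hQ'.mul hd).add (hd'.mul hX))
      have h2 : (q (φ n)).2 (q (φ n)).1 - x' (φ n) (x (φ n)) =
          (q (φ n)).2 ((q (φ n)).1 - x (φ n)) + ((q (φ n)).2 - x' (φ n)) (x (φ n)) := by
        simp only [map_sub, sub_apply]
        ring
      rw [h2]
      exact (norm_add_le _ _).trans (add_le_add ((q (φ n)).2.le_opNorm _)
        (((q (φ n)).2 - x' (φ n)).le_opNorm _))
    simpa using h1.add hP

theorem MonotoneSet.translate {A : Set (E × (E →L[ℝ] ℝ))} (hA : MonotoneSet A)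
    (w : E × (E →L[ℝ] ℝ)) : MonotoneSet {p | p + w ∈ A} := by
  obtain ⟨a, ha⟩ := hA.1
  exact ⟨⟨a - w, by simpa using ha⟩, fun p hp q hq => by simpa using hA.2 _ hp _ hq⟩

theorem Quasidense.translate {A : Set (E × (E →L[ℝ] ℝ))} (h : Quasidense A)
    (w : E × (E →L[ℝ] ℝ)) : Quasidense {p | p + w ∈ A} := by
  intro p
  refine le_trans (le_iInf₂ fun q hq => ?_) (h (p + w))
  have hr : rQ (q - w) p = rQ q (p + w) := by
    simp only [rQ, Prod.fst_sub, Prod.snd_sub, Prod.fst_add, Prod.snd_add, sub_sub, add_comm]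
  rw [← hr]
  exact iInf₂_le (q - w) (by simpa using hq)

/-- Negative alignment pairs with the same ratio of components coincide. -/
theorem NegAlignPair.eq_of_monotoneSet {A : Set (E × (E →L[ℝ] ℝ))} (hA : MonotoneSet A)
    {w : E × (E →L[ℝ] ℝ)} {α β τ τ' : ℝ} (hα : 0 < α) (hβ : 0 < β)
    (h : NegAlignPair A w (α * τ) (β * τ)) (h' : NegAlignPair A w (α * τ') (β * τ')) :
    τ = τ' := by
  obtain ⟨s, hs, h1, h2, h3⟩ := h
  obtain ⟨t, ht, k1, k2, k3⟩ := h'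
  have hlim := (h3.add k3).add ((h2.mul k1).add (k2.mul h1))
  have hnn := ge_of_tendsto' hlim (b := 0) fun n => by
    have e0 := hA.2 _ (hs n) _ (ht n)
    have e1 : ((s n).2 - (t n).2) ((s n).1 - (t n).1) =
        ((s n).2 - w.2) ((s n).1 - w.1) + ((t n).2 - w.2) ((t n).1 - w.1) -
        (((s n).2 - w.2) ((t n).1 - w.1) + ((t n).2 - w.2) ((s n).1 - w.1)) := by
      simp only [map_sub, sub_apply]
      ring
    have e2 := neg_le_of_abs_le (((s n).2 - w.2).le_opNorm ((t n).1 - w.1))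
    have e3 := neg_le_of_abs_le (((t n).2 - w.2).le_opNorm ((s n).1 - w.1))
    linarith
  have hsq : (α * β) * (τ - τ') ^ 2 ≤ 0 := by linarith
  have h0 : (τ - τ') ^ 2 = 0 :=
    le_antisymm (nonpos_of_mul_nonpos_right hsq (by positivity)) (sq_nonneg _)
  linarith [pow_eq_zero_iff (two_ne_zero) |>.1 h0]

theorem statement16 [CompleteSpace E] [Nontrivial E]
    (A : Set (E × (E →L[ℝ] ℝ))) (hclosed : IsClosed A)
    (hmono : MonotoneSet A) (hqd : Quasidense A)
    (w : E × (E →L[ℝ] ℝ)) (α β : ℝ) (hα : 0 < α) (hβ : 0 < β) :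
    ∃! τ : ℝ, 0 ≤ τ ∧ NegAlignPair A w (α * τ) (β * τ) := by
  obtain ⟨ρ, hρ, s, hs, h1, h2, h3⟩ := (hqd.translate w).exists_negAlignPair_zero
    (hmono.translate w) (div_pos hβ hα) (div_pos hα hβ) (by field_simp)
  have hpair : NegAlignPair A w (α * (ρ / α)) (β * (ρ / α)) := by
    have e1 : α * (ρ / α) = ρ := mul_div_cancel₀ _ hα.ne'
    have e2 : β * (ρ / α) = β / α * ρ := by ring
    rw [e1, e2]
    exact ⟨fun n => s n + w, hs, by simpa using h1, by simpa using h2, by simpa using h3⟩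
  exact ⟨ρ / α, ⟨by positivity, hpair⟩, fun τ hτ => hτ.2.eq_of_monotoneSet hmono hα hβ hpair⟩
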